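/- arXiv:2408.10144 — 7 statements merged into one kernel-verified Lean document; each statement's English description precedes it below -/
import Mathlib

section
/- For every real constant k ≥ 6 and all (x, y, z) ∈ ℝ³, setting r = sqrt(1 + x² + y²), one has −2 r z − 2 (r² + z²) · arctan(z / r) + k · r³ · (r² + z²) > 1; consequently the function Φ_k(x, y, z) = 2 r³ / ( −2 r z − 2 (r² + z²) · arctan(z / r) + k · r³ · (r² + z²) ) is well defined and strictly positive on all of ℝ³. -/
/-- For every real `k ≥ 6` and all `(x, y, z) ∈ ℝ³`, with `r = √(1 + x² + y²)`,
the denominator `-2rz - 2(r² + z²)·arctan(z/r) + k·r³·(r² + z²)` is `> 1`, and hence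
the function `Φ_k(x,y,z) = 2r³ / (-2rz - 2(r² + z²)·arctan(z/r) + k·r³·(r² + z²))`
is well defined and strictly positive on all of `ℝ³`. -/
theorem stmt_0 (k : ℝ) (hk : 6 ≤ k) (x y z : ℝ) :
    let r : ℝ := Real.sqrt (1 + x ^ 2 + y ^ 2)
    1 < -2 * r * z - 2 * (r ^ 2 + z ^ 2) * Real.arctan (z / r) + k * r ^ 3 * (r ^ 2 + z ^ 2) ∧
    0 < 2 * r ^ 3 /
      (-2 * r * z - 2 * (r ^ 2 + z ^ 2) * Real.arctan (z / r) + k * r ^ 3 * (r ^ 2 + z ^ 2)) := by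
  intro r
  have hr : 1 ≤ r := Real.one_le_sqrt.2 (by nlinarith [sq_nonneg x, sq_nonneg y])
  have hr3 : 1 ≤ r ^ 3 := one_le_pow₀ hr
  have hS : 1 ≤ r ^ 2 + z ^ 2 := by nlinarith [sq_nonneg z]
  have hk3 : 6 ≤ k * r ^ 3 := by nlinarith
  have hA : 2 * Real.arctan (z / r) ≤ 3.15 := by
    linarith [Real.arctan_lt_pi_div_two (z / r), Real.pi_lt_d2]
  have h : 1 < -2 * r * z - 2 * (r ^ 2 + z ^ 2) * Real.arctan (z / r)
      + k * r ^ 3 * (r ^ 2 + z ^ 2) := by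
    have hS0 : 0 ≤ r ^ 2 + z ^ 2 := by positivity
    linarith [two_mul_le_add_sq r z, mul_le_mul_of_nonneg_left hA hS0,
      mul_le_mul_of_nonneg_right hk3 hS0]
  exact ⟨h, div_pos (by positivity) (by linarith)⟩
end

section
/- Let w : ℝ² → ℝ be any function, fix (x, y, z) ∈ ℝ³, set r = sqrt(1 + x² + y²), D_w(x, y, z) = −2 r z − 2 (r² + z²) arctan(z / r) + w(x, y) · r³ · (r² + z²), and ψ_w(x, y, z) = r³ (r² + z²) / D_w(x, y, z). If D_w(x, y, z) ≠ 0, then the function z' ↦ ψ_w(x, y, z') is differentiable at z and its derivative at z equals ψ_w(x, y, z)² · 4 / (1 + x² + y² + z²)². -/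
/-- Let `w : ℝ² → ℝ`, fix `(x,y,z) ∈ ℝ³`, set `r = √(1 + x² + y²)`,
`D_w(x,y,z) = -2rz - 2(r² + z²)·arctan(z/r) + w(x,y)·r³·(r² + z²)` and
`ψ_w(x,y,z) = r³(r² + z²)/D_w(x,y,z)`. If `D_w(x,y,z) ≠ 0`, then `z' ↦ ψ_w(x,y,z')`
is differentiable at `z` with derivative `ψ_w(x,y,z)² · 4/(1 + x² + y² + z²)²`. -/
theorem stmt_2 (w : ℝ → ℝ → ℝ) (x y z : ℝ) :
    let r : ℝ := Real.sqrt (1 + x ^ 2 + y ^ 2)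
    let D : ℝ → ℝ := fun z' =>
      -2 * r * z' - 2 * (r ^ 2 + z' ^ 2) * Real.arctan (z' / r) +
        w x y * r ^ 3 * (r ^ 2 + z' ^ 2)
    let ψ : ℝ → ℝ := fun z' => r ^ 3 * (r ^ 2 + z' ^ 2) / D z'
    D z ≠ 0 →
      HasDerivAt ψ (ψ z ^ 2 * 4 / (1 + x ^ 2 + y ^ 2 + z ^ 2) ^ 2) z := by
  intro r D ψ hD
  have hpos : 0 < 1 + x ^ 2 + y ^ 2 := by positivity
  have hr : 0 < r := Real.sqrt_pos.mpr hpos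
  have hsq : r ^ 2 = 1 + x ^ 2 + y ^ 2 := Real.sq_sqrt hpos.le
  have hS : r ^ 2 + z ^ 2 ≠ 0 := by positivity
  have hid : HasDerivAt (fun t : ℝ => t) 1 z := hasDerivAt_id z
  have hq : HasDerivAt (fun t : ℝ => r ^ 2 + t ^ 2) (2 * z) z := by
    simpa using (hid.pow 2).const_add (r ^ 2)
  have hA : HasDerivAt (fun t : ℝ => Real.arctan (t / r)) (r / (r ^ 2 + z ^ 2)) z := by
    refine (hid.div_const r).arctan.congr_deriv ?_
    field_simp
  have hD' : HasDerivAt D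
      (-4 * r - 4 * z * Real.arctan (z / r) + 2 * w x y * r ^ 3 * z) z := by
    refine (((hid.const_mul (-2 * r)).sub ((hq.const_mul 2).mul hA)).add
      (hq.const_mul (w x y * r ^ 3))).congr_deriv ?_
    field_simp
    ring
  refine ((hq.const_mul (r ^ 3)).div hD' hD).congr_deriv ?_
  rw [← hsq]
  have hψ : ψ z = r ^ 3 * (r ^ 2 + z ^ 2) / D z := rfl
  have hDz : D z = -2 * r * z - 2 * (r ^ 2 + z ^ 2) * Real.arctan (z / r) +
      w x y * r ^ 3 * (r ^ 2 + z ^ 2) := rfl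
  have hnum : r ^ 3 * (2 * z) * D z - r ^ 3 * (r ^ 2 + z ^ 2) *
      (-4 * r - 4 * z * Real.arctan (z / r) + 2 * w x y * r ^ 3 * z) = 4 * r ^ 6 := by
    rw [hDz]
    ring
  rw [hnum, hψ]
  clear_value D
  field_simp
end

section
/- Fix real numbers x, y and set r = sqrt(1 + x² + y²). Suppose u : ℝ → ℝ is differentiable, u(z) ≠ 0 for every z ∈ ℝ, and u'(z) = 4 u(z)² / (r² + z²)² for every z ∈ ℝ. Then there exists a constant c ∈ ℝ such that for every z ∈ ℝ, 1 / u(z) = c − 2 r z / ( r³ (r² + z²) ) − (2 / r³) arctan(z / r); equivalently, u(z) = r³ (r² + z²) / ( −2 r z − 2 (r² + z²) arctan(z / r) + c · r³ (r² + z²) ) for all z. -/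
/-- An explicit primitive of `z ↦ 4 / (r² + z²)²`. -/
lemma hasDerivAt_primitive_inv_sq_add_sq_sq {r : ℝ} (hr : 0 < r) (z : ℝ) :
    HasDerivAt
      (fun z : ℝ => 2 * r * z / (r ^ 3 * (r ^ 2 + z ^ 2)) + (2 / r ^ 3) * Real.arctan (z / r))
      (4 / (r ^ 2 + z ^ 2) ^ 2) z := by
  have hq : r ^ 2 + z ^ 2 ≠ 0 := by positivity
  have hnum : HasDerivAt (fun z : ℝ => 2 * r * z) (2 * r * 1) z :=
    (hasDerivAt_id z).const_mul (2 * r)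
  have hden : HasDerivAt (fun z : ℝ => r ^ 3 * (r ^ 2 + z ^ 2)) (r ^ 3 * (2 * z)) z := by
    simpa using ((hasDerivAt_pow 2 z).const_add (r ^ 2)).const_mul (r ^ 3)
  have hatan : HasDerivAt (fun z : ℝ => Real.arctan (z / r))
      (1 / (1 + (z / r) ^ 2) * (1 / r)) z :=
    ((hasDerivAt_id z).div_const r).arctan
  have hatan_eq : 1 / (1 + (z / r) ^ 2) * (1 / r) = r / (r ^ 2 + z ^ 2) := by
    have : 1 + (z / r) ^ 2 ≠ 0 := by positivity
    field_simp
  rw [hatan_eq] at hatan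
  refine ((hnum.div hden (by positivity)).add (hatan.const_mul (2 / r ^ 3))).congr_deriv ?_
  field_simp
  ring

/-- Fix `x, y ∈ ℝ` and set `r = √(1 + x² + y²)`. If `u : ℝ → ℝ` is differentiable,
nowhere vanishing, and `u'(z) = 4u(z)²/(r² + z²)²` for all `z`, then there is a constant
`c ∈ ℝ` such that `1/u(z) = c - 2rz/(r³(r² + z²)) - (2/r³)·arctan(z/r)` for all `z`;
equivalently `u(z) = r³(r² + z²)/(-2rz - 2(r² + z²)·arctan(z/r) + c·r³·(r² + z²))`. -/
theorem stmt_3 (x y : ℝ) (u : ℝ → ℝ)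
    (hu : Differentiable ℝ u) (hu0 : ∀ z : ℝ, u z ≠ 0)
    (hode : ∀ z : ℝ,
      deriv u z = 4 * u z ^ 2 / ((Real.sqrt (1 + x ^ 2 + y ^ 2)) ^ 2 + z ^ 2) ^ 2) :
    let r : ℝ := Real.sqrt (1 + x ^ 2 + y ^ 2)
    ∃ c : ℝ, ∀ z : ℝ,
      1 / u z = c - 2 * r * z / (r ^ 3 * (r ^ 2 + z ^ 2)) - (2 / r ^ 3) * Real.arctan (z / r) ∧
      u z = r ^ 3 * (r ^ 2 + z ^ 2) /
        (-2 * r * z - 2 * (r ^ 2 + z ^ 2) * Real.arctan (z / r) + c * r ^ 3 * (r ^ 2 + z ^ 2)) := by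
  intro r
  have hr : 0 < r := Real.sqrt_pos.mpr (by positivity)
  let f : ℝ → ℝ := fun z =>
    (u z)⁻¹ + (2 * r * z / (r ^ 3 * (r ^ 2 + z ^ 2)) + (2 / r ^ 3) * Real.arctan (z / r))
  have hf : ∀ z, HasDerivAt f 0 z := fun z => by
    have hu' : HasDerivAt u (4 * u z ^ 2 / (r ^ 2 + z ^ 2) ^ 2) z :=
      hode z ▸ (hu z).hasDerivAt
    refine ((hu'.inv (hu0 z)).add (hasDerivAt_primitive_inv_sq_add_sq_sq hr z)).congr_deriv ?_
    have := hu0 z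
    have : r ^ 2 + z ^ 2 ≠ 0 := by positivity
    field_simp
    ring
  refine ⟨f 0, fun z => ?_⟩
  have hconst : f z = f 0 :=
    is_const_of_deriv_eq_zero (fun z => (hf z).differentiableAt) (fun z => (hf z).deriv) z 0
  have hinv : 1 / u z =
      f 0 - 2 * r * z / (r ^ 3 * (r ^ 2 + z ^ 2)) - (2 / r ^ 3) * Real.arctan (z / r) := by
    rw [← hconst]
    simp only [f]
    ring
  refine ⟨hinv, ?_⟩
  have hq : r ^ 2 + z ^ 2 ≠ 0 := by positivity
  have hden : -2 * r * z - 2 * (r ^ 2 + z ^ 2) * Real.arctan (z / r) +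
      f 0 * r ^ 3 * (r ^ 2 + z ^ 2) = r ^ 3 * (r ^ 2 + z ^ 2) * (1 / u z) := by
    rw [hinv]
    generalize Real.arctan (z / r) = a
    generalize f 0 = c
    field_simp
    ring
  have := hu0 z
  rw [hden]
  field_simp
end

section
/- Let w : ℝ² → ℝ be twice continuously differentiable with w(x, y) ≠ 0 for all (x, y). Set r = sqrt(1 + x² + y²), D_w(x, y, z) = −2 r z − 2 (r² + z²) arctan(z / r) + w(x, y) · r³ · (r² + z²), and ψ_w(x, y, z) = r³ (r² + z²) / D_w(x, y, z). Then for every (x, y) ∈ ℝ², denoting by ψ_x, ψ_y, ψ_z, ψ_xx, ψ_yy, ψ_zz the first and second partial derivatives of ψ_w in the indicated coordinates, one has, at the point (x, y, 0): ψ_w ψ_xx − 2 ψ_x² + ψ_w ψ_yy − 2 ψ_y² + 2 ψ_w ψ_zz − 4 ψ_z² = − ( w_xx(x, y) + w_yy(x, y) ) / w(x, y)³. -/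
/-- The product of a reciprocal and its second derivative, minus twice its squared derivative. -/
lemma inv_mul_deriv_deriv_inv_sub {f : ℝ → ℝ} {a : ℝ} (hf : ContDiffAt ℝ 2 f a)
    (h0 : f a ≠ 0) :
    (f a)⁻¹ * deriv (deriv (fun t => (f t)⁻¹)) a - 2 * (deriv (fun t => (f t)⁻¹) a) ^ 2 =
      -deriv (deriv f) a / (f a) ^ 3 := by
  have hd : ∀ᶠ t in nhds a, DifferentiableAt ℝ f t :=
    (hf.eventually (by simp)).mono fun t ht => ht.differentiableAt (by simp)
  have hne : ∀ᶠ t in nhds a, f t ≠ 0 := hf.continuousAt.eventually_ne h0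
  have h1 : deriv (fun t => (f t)⁻¹) =ᶠ[nhds a] fun t => -deriv f t / (f t) ^ 2 := by
    filter_upwards [hd, hne] with t ht htne
    exact (ht.hasDerivAt.fun_inv htne).deriv
  have hd2 : DifferentiableAt ℝ (deriv f) a :=
    (ContDiffAt.derivWithin (m := 1) hf (by norm_num)).differentiableAt (by simp)
  have h2 := (hd2.hasDerivAt.fun_neg.fun_div (hd.self_of_nhds.hasDerivAt.fun_pow 2)
    (pow_ne_zero 2 h0)).deriv
  rw [h1.deriv_eq, h1.self_of_nhds, h2]
  field_simp
  ring

/-- A function that is odd up to an additive constant has vanishing second derivative at `0`. -/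
lemma deriv_deriv_zero_of_neg_eq_const_sub {f : ℝ → ℝ} {k : ℝ} (h : ∀ z, f (-z) = k - f z) :
    deriv (deriv f) 0 = 0 := by
  have h1 : ∀ z, deriv f (-z) = deriv f z := fun z => by
    have h2 := deriv_comp_neg f z
    simp only [h, deriv_const_sub] at h2
    linarith
  have h2 := deriv_comp_neg (deriv f) 0
  simp only [h1, neg_zero] at h2
  linarith


/-- Let `w : ℝ² → ℝ` be `C²` with `w(x,y) ≠ 0` everywhere. With `r = √(1 + x² + y²)`,
`D_w(x,y,z) = -2rz - 2(r² + z²)·arctan(z/r) + w(x,y)·r³·(r² + z²)` and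
`ψ_w = r³(r² + z²)/D_w`, at every point `(x, y, 0)` one has
`ψψ_xx - 2ψ_x² + ψψ_yy - 2ψ_y² + 2ψψ_zz - 4ψ_z² = -(w_xx + w_yy)/w³`. -/
theorem stmt_4 (w : ℝ → ℝ → ℝ)
    (hw : ContDiff ℝ 2 (fun p : ℝ × ℝ => w p.1 p.2))
    (hw0 : ∀ x y : ℝ, w x y ≠ 0) (x y : ℝ) :
    let r : ℝ → ℝ → ℝ := fun x' y' => Real.sqrt (1 + x' ^ 2 + y' ^ 2)
    let ψ : ℝ → ℝ → ℝ → ℝ := fun x' y' z' =>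
      (r x' y') ^ 3 * ((r x' y') ^ 2 + z' ^ 2) /
        (-2 * r x' y' * z' - 2 * ((r x' y') ^ 2 + z' ^ 2) * Real.arctan (z' / r x' y') +
          w x' y' * (r x' y') ^ 3 * ((r x' y') ^ 2 + z' ^ 2))
    ψ x y 0 * deriv (deriv (fun t => ψ t y 0)) x - 2 * (deriv (fun t => ψ t y 0) x) ^ 2 +
      ψ x y 0 * deriv (deriv (fun t => ψ x t 0)) y - 2 * (deriv (fun t => ψ x t 0) y) ^ 2 +
      2 * ψ x y 0 * deriv (deriv (fun t => ψ x y t)) 0 - 4 * (deriv (fun t => ψ x y t) 0) ^ 2 =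
    -(deriv (deriv (fun t => w t y)) x + deriv (deriv (fun t => w x t)) y) / (w x y) ^ 3 := by
  intro r ψ
  have hr : ∀ a b, 0 < r a b := fun a b => Real.sqrt_pos.2 (by positivity)
  have hψ0 : ∀ a b, ψ a b 0 = (w a b)⁻¹ := fun a b => by
    have h1 := (hr a b).ne'
    have h2 := hw0 a b
    simp only [ψ, zero_div, Real.arctan_zero]
    field_simp
    ring
  let f : ℝ → ℝ := fun z => w x y - 2 * z / ((r x y) ^ 2 * ((r x y) ^ 2 + z ^ 2)) -
    2 * Real.arctan (z / r x y) / (r x y) ^ 3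
  have hf0 : f 0 = w x y := by simp [f]
  have hψf : (fun t => ψ x y t) = fun t => (f t)⁻¹ := by
    funext t
    have h1 := hr x y
    have h2 : (r x y) ^ 2 + t ^ 2 ≠ 0 := by positivity
    simp only [ψ, f]
    rw [← inv_div]
    congr 1
    field_simp
    ring
  have hf : ContDiffAt ℝ 2 f 0 := by
    have h1 := hr x y
    have h2 : ∀ z : ℝ, (r x y) ^ 2 * ((r x y) ^ 2 + z ^ 2) ≠ 0 := fun z => by positivity
    have h3 : ContDiff ℝ 2 f :=
      (contDiff_const.sub ((contDiff_const.mul contDiff_id).div (by fun_prop) h2)).sub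
        ((contDiff_const.mul (Real.contDiff_arctan.comp (contDiff_id.div_const _))).div_const _)
    exact h3.contDiffAt
  have hfodd : deriv (deriv f) 0 = 0 :=
    deriv_deriv_zero_of_neg_eq_const_sub (k := 2 * w x y) fun z => by
      simp only [f, neg_div, Real.arctan_neg, neg_sq]
      ring
  have hx : ContDiffAt ℝ 2 (fun t => w t y) x :=
    (hw.comp (contDiff_id.prodMk contDiff_const)).contDiffAt
  have hy : ContDiffAt ℝ 2 (fun t => w x t) y :=
    (hw.comp (contDiff_const.prodMk contDiff_id)).contDiffAt
  have ex := inv_mul_deriv_deriv_inv_sub hx (hw0 x y)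
  have ey := inv_mul_deriv_deriv_inv_sub hy (hw0 x y)
  have ez := inv_mul_deriv_deriv_inv_sub hf (hf0 ▸ hw0 x y)
  rw [hfodd, hf0, neg_zero, zero_div] at ez
  rw [hψf]
  simp only [hψ0]
  rw [neg_add, add_div]
  linear_combination ex + ey + 2 * ez
end

section
/- Let c > 0 and C₃, D₃ be real constants, set E = sqrt(1/c + C₃² + D₃²), and define u(s) = C₃ · cos(2√c · s) + D₃ · sin(2√c · s) + E. Then u(s) > 0 for every s ∈ ℝ, and the function κ = 1/u satisfies the ordinary differential equation 3 κ'(s)² − 2 κ(s) κ''(s) = 4 κ(s)² ( κ(s)² − c ) for every s ∈ ℝ. -/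
/-- If `2uu'' - u'² = 4 - 4cu²`, then `κ = 1/u` satisfies `3κ'² - 2κκ'' = 4κ²(κ² - c)`. -/
theorem reciprocal_curvature_equation {u u' u'' : ℝ → ℝ} {c : ℝ}
    (hu : ∀ s, HasDerivAt u (u' s) s) (hu' : ∀ s, HasDerivAt u' (u'' s) s)
    (hne : ∀ s, u s ≠ 0)
    (h : ∀ s, 2 * u s * u'' s - u' s ^ 2 = 4 - 4 * c * u s ^ 2) (s : ℝ) :
    3 * (deriv (fun t => 1 / u t) s) ^ 2 -
        2 * (1 / u s) * deriv (deriv fun t => 1 / u t) s =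
      4 * (1 / u s) ^ 2 * ((1 / u s) ^ 2 - c) := by
  have h1 : deriv (fun t => 1 / u t) = fun t => -u' t / u t ^ 2 := by
    funext t
    simpa only [one_div] using ((hu t).fun_inv (hne t)).deriv
  have h2 : deriv (fun t => -u' t / u t ^ 2) s =
      (-u'' s * u s ^ 2 - -u' s * (2 * u s * u' s)) / (u s ^ 2) ^ 2 := by
    have hsq : HasDerivAt (fun t => u t ^ 2) (2 * u s * u' s) s := by
      simpa using (hu s).fun_pow 2
    exact ((hu' s).fun_neg.fun_div hsq (pow_ne_zero 2 (hne s))).deriv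
  have hs := hne s
  rw [h1, h2]
  field_simp
  linear_combination h s

/-- A sinusoid plus a constant exceeding its amplitude is positive. -/
theorem cos_add_sin_add_sqrt_pos {a : ℝ} (ha : 0 < a) (C D x : ℝ) :
    0 < C * Real.cos x + D * Real.sin x + Real.sqrt (a + C ^ 2 + D ^ 2) := by
  have h : -(C * Real.cos x + D * Real.sin x) < Real.sqrt (a + C ^ 2 + D ^ 2) := by
    apply Real.lt_sqrt_of_sq_lt
    have hxx : (C * Real.cos x + D * Real.sin x) ^ 2 +
        (C * Real.sin x - D * Real.cos x) ^ 2 = C ^ 2 + D ^ 2 := by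
      linear_combination (C ^ 2 + D ^ 2) * Real.sin_sq_add_cos_sq x
    nlinarith [sq_nonneg (C * Real.sin x - D * Real.cos x)]
  linarith

theorem hasDerivAt_cos_add_sin_add_const (C D E ω s : ℝ) :
    HasDerivAt (fun t => C * Real.cos (ω * t) + D * Real.sin (ω * t) + E)
      (D * ω * Real.cos (ω * s) + -(C * ω) * Real.sin (ω * s)) s := by
  have hl : HasDerivAt (fun t => ω * t) ω s := by
    simpa using (hasDerivAt_id s).const_mul ω
  exact (((hl.cos.const_mul C).fun_add (hl.sin.const_mul D)).add_const E).congr_deriv (by ring)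

/-- Let `c > 0`, `C₃, D₃ ∈ ℝ`, `E = √(1/c + C₃² + D₃²)` and
`u(s) = C₃·cos(2√c·s) + D₃·sin(2√c·s) + E`. Then `u > 0` everywhere and
`κ = 1/u` satisfies `3κ'² - 2κκ'' = 4κ²(κ² - c)` on all of `ℝ`. -/
theorem stmt_8 (c C₃ D₃ : ℝ) (hc : 0 < c) :
    let E : ℝ := Real.sqrt (1 / c + C₃ ^ 2 + D₃ ^ 2)
    let u : ℝ → ℝ := fun s =>
      C₃ * Real.cos (2 * Real.sqrt c * s) + D₃ * Real.sin (2 * Real.sqrt c * s) + E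
    let κ : ℝ → ℝ := fun s => 1 / u s
    (∀ s : ℝ, 0 < u s) ∧
    (∀ s : ℝ, 3 * (deriv κ s) ^ 2 - 2 * κ s * deriv (deriv κ) s =
      4 * (κ s) ^ 2 * ((κ s) ^ 2 - c)) := by
  intro E u κ
  have hpos : ∀ s, 0 < u s := fun s =>
    cos_add_sin_add_sqrt_pos (one_div_pos.mpr hc) C₃ D₃ _
  refine ⟨hpos, ?_⟩
  have hE : c * E ^ 2 = 1 + c * (C₃ ^ 2 + D₃ ^ 2) := by
    have hE0 : E ^ 2 = 1 / c + C₃ ^ 2 + D₃ ^ 2 := Real.sq_sqrt (by positivity)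
    rw [hE0]
    field_simp
    ring
  have hω : Real.sqrt c ^ 2 = c := Real.sq_sqrt hc.le
  set ω := 2 * Real.sqrt c with hωdef
  have hω2 : ω ^ 2 = 4 * c := by rw [hωdef, mul_pow, hω]; norm_num
  refine reciprocal_curvature_equation
    (u' := fun s => D₃ * ω * Real.cos (ω * s) + -(C₃ * ω) * Real.sin (ω * s))
    (u'' := fun s => -(C₃ * ω) * ω * Real.cos (ω * s) + -(D₃ * ω * ω) * Real.sin (ω * s))
    (fun s => hasDerivAt_cos_add_sin_add_const C₃ D₃ E ω s) (fun s => ?_)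
    (fun s => (hpos s).ne') (fun s => ?_)
  · simpa using hasDerivAt_cos_add_sin_add_const (D₃ * ω) (-(C₃ * ω)) 0 ω s
  · have htrig := Real.sin_sq_add_cos_sq (ω * s)
    simp only [u]
    generalize Real.cos (ω * s) = x at *
    generalize Real.sin (ω * s) = y at *
    linear_combination
      (-2 * (C₃ * x + D₃ * y + E) * (C₃ * x + D₃ * y) - (D₃ * x - C₃ * y) ^ 2) * hω2 +
      4 * hE - 4 * c * (C₃ ^ 2 + D₃ ^ 2) * htrig
end

section
/- Let C₂ ≠ 0 and D₂ be real constants and define κ(s) = 4 C₂ / ( 16 + C₂² (s + D₂)² ). Then κ satisfies the ordinary differential equation 3 κ'(s)² − 2 κ(s) κ''(s) = 4 κ(s)⁴ for every s ∈ ℝ. -/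
/-- Let `C₂ ≠ 0` and `D₂` be real constants and `κ(s) = 4C₂/(16 + C₂²(s + D₂)²)`.
Then `3κ'(s)² - 2κ(s)κ''(s) = 4κ(s)⁴` for every `s ∈ ℝ`. -/
theorem stmt_9 (C₂ D₂ : ℝ) (hC₂ : C₂ ≠ 0) :
    let κ : ℝ → ℝ := fun s => 4 * C₂ / (16 + C₂ ^ 2 * (s + D₂) ^ 2)
    ∀ s : ℝ, 3 * (deriv κ s) ^ 2 - 2 * κ s * deriv (deriv κ) s = 4 * (κ s) ^ 4 := by
  intro κ s
  have hpos (t : ℝ) : 16 + C₂ ^ 2 * (t + D₂) ^ 2 ≠ 0 := by positivity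
  have hlin (t : ℝ) : HasDerivAt (fun s : ℝ => s + D₂) 1 t := (hasDerivAt_id t).add_const D₂
  have hden (t : ℝ) : HasDerivAt (fun s : ℝ => 16 + C₂ ^ 2 * (s + D₂) ^ 2)
      (2 * C₂ ^ 2 * (t + D₂)) t := by
    refine ((((hlin t).fun_pow 2).const_mul (C₂ ^ 2)).const_add 16).congr_deriv ?_
    push_cast
    ring
  have hκ : deriv κ = fun t =>
      -(8 * C₂ ^ 3) * (t + D₂) / (16 + C₂ ^ 2 * (t + D₂) ^ 2) ^ 2 := by
    funext t
    refine (((hasDerivAt_const t (4 * C₂)).fun_div (hden t) (hpos t)).congr_deriv ?_).deriv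
    ring
  have hκ' := (((hlin s).const_mul (-(8 * C₂ ^ 3))).fun_div ((hden s).fun_pow 2)
    (pow_ne_zero 2 (hpos s))).deriv
  rw [hκ, hκ']
  have h := hpos s
  simp only [κ]
  push_cast
  field_simp
  ring
end

section
/- Let c < 0 and C₁, D₁ be real constants with 4 C₁ D₁ + 1/c ≥ 0, set E = sqrt(4 C₁ D₁ + 1/c), and define u(s) = C₁ · exp(2√(−c) · s) + D₁ · exp(−2√(−c) · s) + E. Then at every s ∈ ℝ with u(s) ≠ 0, the function κ = 1/u (defined near s) satisfies 3 κ'(s)² − 2 κ(s) κ''(s) = 4 κ(s)² ( κ(s)² − c ). -/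
/-- The second derivative of `1 / u` at a point where the twice differentiable `u` is nonzero. -/
theorem hasDerivAt_deriv_one_div {u u' : ℝ → ℝ} {u'' s : ℝ} (hu : ∀ x, HasDerivAt u (u' x) x)
    (hu' : HasDerivAt u' u'' s) (hs : u s ≠ 0) :
    HasDerivAt (deriv fun x => 1 / u x) (2 * u' s ^ 2 / u s ^ 3 - u'' / u s ^ 2) s := by
  have hderiv : deriv (fun x => 1 / u x) =ᶠ[nhds s] fun x => -u' x / u x ^ 2 := by
    filter_upwards [(hu s).continuousAt.eventually_ne hs] with x hx
    simpa only [one_div] using ((hu x).fun_inv hx).deriv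
  refine HasDerivAt.congr_of_eventuallyEq ?_ hderiv
  refine (hu'.fun_neg.fun_div ((hu s).fun_pow 2) (pow_ne_zero 2 hs)).congr_deriv ?_
  push_cast
  field_simp
  ring

/-- If `2 u u'' - u'² = 4 - 4 c u²` at `s`, then `κ = 1 / u` solves the curvature equation there. -/
theorem curvature_eq_of_reciprocal {u u' : ℝ → ℝ} {u'' s c : ℝ}
    (hu : ∀ x, HasDerivAt u (u' x) x) (hu' : HasDerivAt u' u'' s) (hs : u s ≠ 0)
    (h : 2 * u s * u'' - u' s ^ 2 = 4 - 4 * c * u s ^ 2) :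
    3 * (deriv (fun x => 1 / u x) s) ^ 2 - 2 * (1 / u s) * deriv (deriv fun x => 1 / u x) s =
      4 * (1 / u s) ^ 2 * ((1 / u s) ^ 2 - c) := by
  have hderiv : deriv (fun x => 1 / u x) s = -u' s / u s ^ 2 := by
    simpa only [one_div] using ((hu s).fun_inv hs).deriv
  rw [(hasDerivAt_deriv_one_div hu hu' hs).deriv, hderiv]
  field_simp
  linear_combination h

/-- The derivative of `A exp (a x) + B exp (-(a x)) + E`. -/
theorem hasDerivAt_exp_add_exp_neg (a A B E x : ℝ) :
    HasDerivAt (fun s => A * Real.exp (a * s) + B * Real.exp (-(a * s)) + E)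
      (a * A * Real.exp (a * x) + -(a * B) * Real.exp (-(a * x)) + 0) x := by
  have hlin : HasDerivAt (fun s => a * s) a x := by
    simpa using (hasDerivAt_id x).const_mul a
  refine (((hlin.exp.const_mul A).fun_add
    (hlin.fun_neg.exp.const_mul B)).add_const E).congr_deriv ?_
  ring

/-- Let `c < 0`, `C₁, D₁ ∈ ℝ` with `4C₁D₁ + 1/c ≥ 0`, `E = √(4C₁D₁ + 1/c)` and
`u(s) = C₁·exp(2√(-c)·s) + D₁·exp(-2√(-c)·s) + E`. Then at every `s` with `u(s) ≠ 0`,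
the function `κ = 1/u` satisfies `3κ'(s)² - 2κ(s)κ''(s) = 4κ(s)²(κ(s)² - c)`. -/
theorem stmt_10 (c C₁ D₁ : ℝ) (hc : c < 0) (hCD : 0 ≤ 4 * C₁ * D₁ + 1 / c) :
    let E : ℝ := Real.sqrt (4 * C₁ * D₁ + 1 / c)
    let u : ℝ → ℝ := fun s =>
      C₁ * Real.exp (2 * Real.sqrt (-c) * s) + D₁ * Real.exp (-(2 * Real.sqrt (-c) * s)) + E
    let κ : ℝ → ℝ := fun s => 1 / u s
    ∀ s : ℝ, u s ≠ 0 →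
      3 * (deriv κ s) ^ 2 - 2 * κ s * deriv (deriv κ) s =
        4 * (κ s) ^ 2 * ((κ s) ^ 2 - c) := by
  intro E u κ s hs
  have hE : E ^ 2 = 4 * C₁ * D₁ + 1 / c := Real.sq_sqrt hCD
  have hcE : c * E ^ 2 = 4 * c * C₁ * D₁ + 1 := by
    rw [hE]
    field_simp [hc.ne]
  have hsqrt : Real.sqrt (-c) ^ 2 = -c := Real.sq_sqrt (by linarith)
  refine curvature_eq_of_reciprocal (hasDerivAt_exp_add_exp_neg _ C₁ D₁ E)
    (hasDerivAt_exp_add_exp_neg _ _ _ 0 s) hs ?_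
  have hexp : Real.exp (2 * Real.sqrt (-c) * s) * Real.exp (-(2 * Real.sqrt (-c) * s)) = 1 := by
    rw [← Real.exp_add, add_neg_cancel, Real.exp_zero]
  simp only [u]
  generalize Real.exp (2 * Real.sqrt (-c) * s) = p at *
  generalize Real.exp (-(2 * Real.sqrt (-c) * s)) = q at *
  linear_combination (8 * (C₁ * p + D₁ * q + E) * (C₁ * p + D₁ * q)
    - 4 * (C₁ * p - D₁ * q) ^ 2) * hsqrt + 4 * hcE - 16 * c * C₁ * D₁ * hexp
end
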